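/- arXiv:2506.21070 — 2 statements merged into one kernel-verified Lean document; each statement's English description precedes it below -/
import Mathlib

section
/- For 0<α≤1 and all t≥0, the Mittag-Leffler function satisfies 0 < E_{α,1}(−t) ≤ 1. -/
open Real

/-- The real Mittag-Leffler function `E_{α,β}(x) = Σ_{k=0}^∞ x^k / Γ(αk+β)`. -/
noncomputable def mittagLeffler (α β x : ℝ) : ℝ :=
  ∑' k : ℕ, x ^ k / Real.Gamma (α * k + β)

open Set Filter Topology MeasureTheory

namespace MLaux

lemma gamma_lower {x M : ℝ} (hx : 0 ≤ x) (hM : 0 < M) :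
    M ^ x * Real.exp (-M) ≤ Real.Gamma (x + 1) := by
  have hI := Real.GammaIntegral_convergent (s := x + 1) (by linarith)
  rw [Real.Gamma_eq_integral (by linarith), ← integral_exp_neg_Ioi M, ← integral_const_mul]
  have hsub : Ioi M ⊆ Ioi (0:ℝ) := Ioi_subset_Ioi hM.le
  calc ∫ a in Ioi M, M ^ x * Real.exp (-a)
      ≤ ∫ a in Ioi M, Real.exp (-a) * a ^ (x + 1 - 1) := by
        apply setIntegral_mono_on
        · exact (integrableOn_exp_neg_Ioi M).const_mul _
        · exact hI.mono_set hsub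
        · exact measurableSet_Ioi
        · intro a ha
          rw [mul_comm, add_sub_cancel_right]
          have : M ^ x ≤ a ^ x := Real.rpow_le_rpow hM.le (le_of_lt ha) hx
          gcongr
    _ ≤ _ := by
        apply setIntegral_mono_set hI
        · filter_upwards [ae_restrict_mem measurableSet_Ioi] with a ha
          have : (0:ℝ) < a := ha
          simp only [Pi.zero_apply]
          positivity
        · exact hsub.eventuallyLE

lemma gamma_pos {α : ℝ} (hα : 0 < α) (k : ℕ) : 0 < Real.Gamma (α * k + 1) :=
  Real.Gamma_pos_of_pos (by positivity)

lemma summable_pos {α : ℝ} (hα : 0 < α) {R : ℝ} (hR : 0 < R) :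
    Summable fun k : ℕ => R ^ k / Real.Gamma (α * k + 1) := by
  set M : ℝ := (2 * R) ^ (α⁻¹) with hMdef
  have hM : 0 < M := by positivity
  have hMa : M ^ α = 2 * R := by
    rw [hMdef, ← Real.rpow_mul (by positivity), inv_mul_cancel₀ hα.ne', Real.rpow_one]
  have hs : Summable fun k : ℕ => Real.exp M * (1 / 2 : ℝ) ^ k :=
    (summable_geometric_of_lt_one (by norm_num) (by norm_num)).mul_left _
  refine Summable.of_nonneg_of_le (fun k => ?_) (fun k => ?_) hs
  · have := gamma_pos hα k
    positivity
  · have h1 := gamma_lower (x := α * k) (by positivity) hM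
    rw [Real.rpow_mul hM.le, hMa, Real.rpow_natCast] at h1
    rw [div_le_iff₀ (gamma_pos hα k)]
    calc R ^ k = Real.exp M * (1/2)^k * ((2 * R) ^ k * Real.exp (-M)) := by
          rw [mul_pow, Real.exp_neg]
          have : (1/2:ℝ)^k * 2^k = 1 := by rw [← mul_pow]; norm_num
          field_simp
          exact this.symm
      _ ≤ _ := by gcongr

lemma summable_all {α : ℝ} (hα : 0 < α) (x : ℝ) :
    Summable fun k : ℕ => x ^ k / Real.Gamma (α * k + 1) := by
  refine Summable.of_norm_bounded (summable_pos hα (R := |x| + 1) (by positivity)) fun k => ?_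
  have := gamma_pos hα k
  rw [norm_div, norm_pow, Real.norm_eq_abs, Real.norm_eq_abs, abs_of_pos this]
  gcongr
  linarith

lemma differentiable_ml {α : ℝ} (hα : 0 < α) : Differentiable ℝ (mittagLeffler α 1) := by
  intro x
  set R : ℝ := |x| + 1
  have hR : 0 < R := by positivity
  have hu : Summable fun k : ℕ => (2 * R + 2) ^ k / Real.Gamma (α * k + 1) :=
    summable_pos hα (by positivity)
  refine (hasDerivAt_tsum_of_isPreconnected (𝕜 := ℝ) (t := Metric.ball (0:ℝ) R) (y₀ := 0)
    (g := fun (k : ℕ) y => y ^ k / Real.Gamma (α * k + 1))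
    (g' := fun (k : ℕ) y => (k * y ^ (k - 1)) / Real.Gamma (α * k + 1))
    hu Metric.isOpen_ball (convex_ball _ _).isPreconnected ?_ ?_ ?_ (summable_all hα 0)
    ?_).differentiableAt
  · intro k y _
    exact (hasDerivAt_pow k y).div_const _
  · intro k y hy
    have hy' : |y| < R := by simpa using hy
    have := gamma_pos hα k
    rw [norm_div, norm_mul, norm_pow, Real.norm_eq_abs, Real.norm_eq_abs, Real.norm_eq_abs,
      abs_of_pos this]
    gcongr
    have h1 : |(k:ℝ)| ≤ 2 ^ k := by
      rw [Nat.abs_cast]; exact_mod_cast Nat.lt_two_pow_self.le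
    have h2 : |y| ^ (k - 1) ≤ (R + 1) ^ k :=
      calc |y| ^ (k - 1) ≤ (R + 1) ^ (k - 1) := by gcongr; linarith
        _ ≤ (R + 1) ^ k := pow_le_pow_right₀ (by linarith) (by omega)
    calc |(k:ℝ)| * |y| ^ (k - 1) ≤ 2 ^ k * (R + 1) ^ k := by gcongr
      _ = (2 * R + 2) ^ k := by rw [← mul_pow]; ring
  · simpa using hR
  · simp [R]

lemma beta_real {α b a : ℝ} (hα : 0 < α) (hb : 0 < b) (ha : 0 < a) :
    ∫ r in (0:ℝ)..a, (a - r) ^ (α - 1) * r ^ (b - 1) =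
      a ^ (b + α - 1) * (Real.Gamma b * Real.Gamma α / Real.Gamma (b + α)) := by
  have h := Complex.betaIntegral_scaled (b : ℂ) (α : ℂ) ha
  rw [Complex.betaIntegral_eq_Gamma_mul_div _ _ (by simpa) (by simpa)] at h
  have e : ∫ x in (0:ℝ)..a, (x : ℂ) ^ ((b:ℂ) - 1) * ((a : ℂ) - x) ^ ((α:ℂ) - 1)
      = ∫ x in (0:ℝ)..a, (((a - x) ^ (α - 1) * x ^ (b - 1) : ℝ) : ℂ) := by
    apply intervalIntegral.integral_congr
    intro x hx
    rw [uIcc_of_le ha.le] at hx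
    simp only
    rw [Complex.ofReal_mul, Complex.ofReal_cpow hx.1, Complex.ofReal_cpow (by linarith [hx.2])]
    push_cast
    ring
  rw [e, intervalIntegral.integral_ofReal] at h
  have e2 : ((b:ℂ) + α - 1) = ((b + α - 1 : ℝ) : ℂ) := by push_cast; ring
  rw [e2, ← Complex.ofReal_cpow ha.le, ← Complex.ofReal_add, Complex.Gamma_ofReal,
    Complex.Gamma_ofReal, Complex.Gamma_ofReal] at h
  exact_mod_cast h

lemma kernel_int {α : ℝ} (hα : 0 < α) (a u v : ℝ) :
    IntervalIntegrable (fun r : ℝ => (a - r) ^ (α - 1)) volume u v := by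
  have := (intervalIntegral.intervalIntegrable_rpow' (r := α - 1) (a := a - u) (b := a - v)
    (by linarith)).comp_sub_left a
  simpa using this

/-- The function `s ↦ E_α(-s^α)`. -/
noncomputable def F (α s : ℝ) : ℝ := mittagLeffler α 1 (-(s ^ α))

lemma F_cont {α : ℝ} (hα : 0 < α) : Continuous (F α) :=
  (differentiable_ml hα).continuous.comp (Real.continuous_rpow_const hα.le).neg

lemma F_diff {α : ℝ} (hα : 0 < α) {s : ℝ} (hs : 0 < s) : DifferentiableAt ℝ (F α) s :=
  ((differentiable_ml hα) _).comp s
    (Real.differentiableAt_rpow_const_of_ne α hs.ne').neg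

lemma F_zero {α : ℝ} (hα : 0 < α) : F α 0 = 1 := by
  unfold F mittagLeffler
  rw [Real.zero_rpow hα.ne', neg_zero, tsum_eq_single 0]
  · simp
  · intro k hk; simp [hk]

lemma volterra {α : ℝ} (hα : 0 < α) {s : ℝ} (hs : 0 < s) :
    F α s = 1 - (Real.Gamma α)⁻¹ * ∫ r in (0:ℝ)..s, (s - r) ^ (α - 1) * F α r := by
  have hG := Real.Gamma_pos_of_pos hα
  have hsum := intervalIntegral.hasSum_integral_of_dominated_convergence
    (μ := volume) (a := (0:ℝ)) (b := s)
    (F := fun (k : ℕ) r => (s - r) ^ (α - 1) * ((-(r ^ α)) ^ k / Real.Gamma (α * k + 1)))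
    (f := fun r => (s - r) ^ (α - 1) * F α r)
    (fun (k : ℕ) r => (s - r) ^ (α - 1) * ((s ^ α) ^ k / Real.Gamma (α * k + 1)))
    ?_ ?_ ?_ ?_ ?_
  · have hterm : ∀ k : ℕ, ∫ r in (0:ℝ)..s,
        (s - r) ^ (α - 1) * ((-(r ^ α)) ^ k / Real.Gamma (α * k + 1))
        = - Real.Gamma α * ((-(s ^ α)) ^ (k + 1) / Real.Gamma (α * (k + 1 : ℕ) + 1)) := by
      intro k
      have hb := beta_real hα (b := α * k + 1) (by positivity) hs
      have hgk := gamma_pos hα k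
      have e : ∫ r in (0:ℝ)..s,
        (s - r) ^ (α - 1) * ((-(r ^ α)) ^ k / Real.Gamma (α * k + 1))
        = ∫ r in (0:ℝ)..s, ((-1) ^ k / Real.Gamma (α * k + 1)) *
          ((s - r) ^ (α - 1) * r ^ (α * k + 1 - 1)) := by
        apply intervalIntegral.integral_congr
        intro r hr
        rw [uIcc_of_le hs.le] at hr
        simp only
        rw [add_sub_cancel_right, Real.rpow_mul hr.1, Real.rpow_natCast, neg_pow]
        ring
      rw [e, intervalIntegral.integral_const_mul, hb]
      have e2 : α * k + 1 + α - 1 = α * ((k + 1 : ℕ) : ℝ) := by push_cast; ring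
      have e3 : α * k + 1 + α = α * ((k + 1 : ℕ) : ℝ) + 1 := by push_cast; ring
      rw [e2, e3, Real.rpow_mul hs.le, Real.rpow_natCast, neg_pow (s ^ α), pow_succ (-1 : ℝ)]
      field_simp
    simp_rw [hterm] at hsum
    rw [← hsum.tsum_eq, tsum_mul_left]
    have h0 := (summable_all hα (-(s ^ α))).tsum_eq_zero_add
    unfold F mittagLeffler
    rw [h0]
    simp
    field_simp
  · intro k
    apply Measurable.aestronglyMeasurable
    fun_prop
  · intro k
    refine ae_of_all _ fun r hr => ?_
    rw [uIoc_of_le hs.le] at hr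
    have := gamma_pos hα k
    have h1 : 0 ≤ s - r := by linarith [hr.2]
    have h2 : 0 ≤ r := hr.1.le
    rw [norm_mul, norm_div, norm_pow, norm_neg, Real.norm_of_nonneg (by positivity),
      Real.norm_of_nonneg (by positivity), Real.norm_of_nonneg this.le]
    have := hr.2
    gcongr
  · exact ae_of_all _ fun r hr => (summable_all hα _).mul_left _
  · simp_rw [tsum_mul_left]
    exact (kernel_int hα s 0 s).mul_const _
  · exact ae_of_all _ fun r hr => (summable_all hα _).hasSum.mul_left _

lemma kernel_F_int {α : ℝ} (hα : 0 < α) (a u v : ℝ) :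
    IntervalIntegrable (fun r : ℝ => (a - r) ^ (α - 1) * F α r) volume u v :=
  (kernel_int hα a u v).mul_continuousOn (F_cont hα).continuousOn

lemma no_first_zero {α : ℝ} (hα : 0 < α) (hα1 : α < 1) {b : ℝ} (hb : 0 < b)
    (hpos : ∀ r, 0 ≤ r → r < b → 0 < F α r) (hF : F α b ≤ 0) : False := by
  have hG := Real.Gamma_pos_of_pos hα
  set c : ℝ := (Real.Gamma α)⁻¹ with hc
  have hcpos : 0 < c := by positivity
  -- local Lipschitz bound
  obtain ⟨C, hCpos, hC⟩ := ((F_diff hα hb).hasDerivAt.isBigO_sub).exists_pos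
  rw [Asymptotics.isBigOWith_iff, Metric.eventually_nhds_iff] at hC
  obtain ⟨ε, hε, hC⟩ := hC
  have hlip : ∀ r, b - ε < r → r ≤ b → F α r ≤ C * (b - r) := by
    intro r h1 h2
    have h3 := hC (y := r) (by rw [Real.dist_eq, abs_lt]; constructor <;> linarith)
    rw [Real.norm_eq_abs, Real.norm_eq_abs, abs_sub_comm r b, abs_of_nonneg (by linarith : 0 ≤ b - r)]
      at h3
    linarith [le_abs_self (F α r - F α b)]
  -- key inequality
  have key : ∀ δ, 0 < δ → δ < ε → δ < b → (1 - α) / b ≤ c * C * δ ^ α := by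
    intro δ hδ hδε hδb
    set s : ℝ := b - δ with hs
    have hspos : 0 < s := by linarith
    have hsb : s < b := by linarith
    set ρ : ℝ := (s / b) ^ (1 - α) with hρ
    have hρle : ρ ≤ 1 - (1 - α) / b * δ := by
      have h := _root_.rpow_one_add_le_one_add_mul_self (s := -(δ / b)) (p := 1 - α)
        (by rw [neg_le_neg_iff, div_le_one hb]; exact hδb.le) (by linarith) (by linarith)
      have e : 1 + -(δ / b) = s / b := by rw [hs]; field_simp; ring
      rw [e] at h
      calc ρ ≤ _ := h
        _ = _ := by ring
    have hρpos : 0 < ρ := by positivity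
    have h1 : ∫ r in (0:ℝ)..s, (b - r) ^ (α - 1) * F α r
        ≤ ρ * ∫ r in (0:ℝ)..s, (s - r) ^ (α - 1) * F α r := by
      rw [← intervalIntegral.integral_const_mul]
      apply intervalIntegral.integral_mono_on_of_le_Ioo hspos.le (kernel_F_int hα b 0 s)
        ((kernel_F_int hα s 0 s).const_mul ρ)
      intro r hr
      have hf := hpos r hr.1.le (hr.2.trans hsb)
      have hsr : 0 < s - r := by linarith [hr.2]
      have hbr : 0 < b - r := by linarith [hr.2]
      rw [← mul_assoc]
      apply mul_le_mul_of_nonneg_right _ hf.le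
      have e1 : (b - r) ^ (α - 1) = ((s - r) / (b - r)) ^ (1 - α) * (s - r) ^ (α - 1) := by
        rw [Real.div_rpow hsr.le hbr.le, show α - 1 = -(1 - α) by ring, Real.rpow_neg hbr.le,
          Real.rpow_neg hsr.le]
        have : 0 < (s - r) ^ (1 - α) := by positivity
        field_simp
      rw [e1]
      have h2 : (s - r) / (b - r) ≤ s / b := by
        rw [div_le_div_iff₀ hbr hb]
        nlinarith [hr.1]
      have h3 : ((s - r) / (b - r)) ^ (1 - α) ≤ ρ :=
        Real.rpow_le_rpow (by positivity) h2 (by linarith)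
      gcongr
    have h2 : ∫ r in s..b, (b - r) ^ (α - 1) * F α r ≤ C * δ ^ α * δ := by
      have : ∫ r in s..b, (b - r) ^ (α - 1) * F α r ≤ ∫ r in s..b, C * δ ^ α := by
        apply intervalIntegral.integral_mono_on_of_le_Ioo hsb.le (kernel_F_int hα b s b)
          intervalIntegrable_const
        intro r hr
        have hbr : 0 < b - r := by linarith [hr.2]
        calc (b - r) ^ (α - 1) * F α r ≤ (b - r) ^ (α - 1) * (C * (b - r)) := by
              gcongr
              exact hlip r (by linarith [hr.1]) hr.2.le
          _ = C * (b - r) ^ α := by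
              rw [Real.rpow_sub_one hbr.ne']; field_simp
          _ ≤ C * δ ^ α := by
              gcongr
              linarith [hr.1]
      rw [intervalIntegral.integral_const, smul_eq_mul] at this
      calc _ ≤ _ := this
        _ = _ := by rw [hs]; ring
    have hvb := volterra hα hb
    have hvs := volterra hα hspos
    have hFs := hpos s hspos.le hsb
    rw [← intervalIntegral.integral_add_adjacent_intervals (kernel_F_int hα b 0 s)
      (kernel_F_int hα b s b), mul_add] at hvb
    rw [← hc] at hvb hvs
    have h1' := mul_le_mul_of_nonneg_left h1 hcpos.le
    have h2' := mul_le_mul_of_nonneg_left h2 hcpos.le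
    have h3 : c * (ρ * ∫ r in (0:ℝ)..s, (s - r) ^ (α - 1) * F α r) = ρ * (1 - F α s) := by
      rw [hvs]; ring
    rw [h3] at h1'
    have h4 : (1 - α) / b * δ ≤ (c * C * δ ^ α) * δ := by
      have := mul_pos hρpos hFs
      nlinarith
    exact le_of_mul_le_mul_right h4 hδ
  have hlim : Tendsto (fun δ : ℝ => c * C * δ ^ α) (𝓝[>] 0) (𝓝 (c * C * (0:ℝ) ^ α)) :=
    (((Real.continuous_rpow_const hα.le).const_mul (c * C)).tendsto 0).mono_left
      nhdsWithin_le_nhds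
  have hle : (1 - α) / b ≤ c * C * (0:ℝ) ^ α := by
    refine ge_of_tendsto hlim ?_
    filter_upwards [Ioo_mem_nhdsGT (lt_min hε hb)] with δ hδ
    exact key δ hδ.1 (hδ.2.trans_le (min_le_left _ _)) (hδ.2.trans_le (min_le_right _ _))
  rw [Real.zero_rpow hα.ne', mul_zero] at hle
  have : 0 < (1 - α) / b := div_pos (by linarith) hb
  linarith

lemma F_pos {α : ℝ} (hα : 0 < α) (hα1 : α < 1) {s : ℝ} (hs : 0 ≤ s) : 0 < F α s := by
  by_contra hcon
  have hcomp : IsCompact (Icc 0 s ∩ {x | F α x ≤ 0}) :=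
    isCompact_Icc.inter_right (isClosed_le (F_cont hα) continuous_const)
  obtain ⟨b, hb⟩ := hcomp.exists_isLeast ⟨s, ⟨hs, le_rfl⟩, not_lt.mp hcon⟩
  have hbF : F α b ≤ 0 := hb.1.2
  have hb0 : 0 < b := by
    rcases hb.1.1.1.eq_or_lt with h | h
    · rw [← h, F_zero hα] at hbF
      linarith
    · exact h
  refine no_first_zero hα hα1 hb0 (fun r hr hrb => ?_) hbF
  by_contra hr2
  have := hb.2 ⟨⟨hr, hrb.le.trans hb.1.1.2⟩, not_lt.mp hr2⟩
  linarith

lemma F_le_one {α : ℝ} (hα : 0 < α) (hα1 : α < 1) {s : ℝ} (hs : 0 ≤ s) : F α s ≤ 1 := by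
  rcases hs.eq_or_lt with h | h
  · rw [← h, F_zero hα]
  · rw [volterra hα h]
    have hG := Real.Gamma_pos_of_pos hα
    have : 0 ≤ ∫ r in (0:ℝ)..s, (s - r) ^ (α - 1) * F α r := by
      apply intervalIntegral.integral_nonneg hs
      intro r hr
      exact mul_nonneg (Real.rpow_nonneg (by linarith [hr.2]) _) (F_pos hα hα1 hr.1).le
    have := mul_nonneg (inv_pos.mpr hG).le this
    linarith

end MLaux

/-- For `0 < α ≤ 1` and all `t ≥ 0`, `0 < E_{α,1}(−t) ≤ 1`. -/
theorem mittagLeffler_pos_le_one (α : ℝ) (hα : 0 < α) (hα1 : α ≤ 1) :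
    ∀ t : ℝ, 0 ≤ t → 0 < mittagLeffler α 1 (-t) ∧ mittagLeffler α 1 (-t) ≤ 1 := by
  intro t ht
  rcases hα1.eq_or_lt with h | h
  · have e : mittagLeffler α 1 (-t) = Real.exp (-t) := by
      rw [h, Real.exp_eq_exp_ℝ, NormedSpace.exp_eq_tsum_div]
      unfold mittagLeffler
      congr 1
      ext k
      rw [one_mul, Real.Gamma_nat_eq_factorial]
    rw [e]
    exact ⟨Real.exp_pos _, Real.exp_le_one_iff.mpr (by linarith)⟩
  · have e : mittagLeffler α 1 (-t) = MLaux.F α (t ^ α⁻¹) := by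
      unfold MLaux.F
      rw [← Real.rpow_mul ht, inv_mul_cancel₀ hα.ne', Real.rpow_one]
    rw [e]
    have hs : 0 ≤ t ^ α⁻¹ := Real.rpow_nonneg ht _
    exact ⟨MLaux.F_pos hα h hs, MLaux.F_le_one hα h hs⟩
end

section
/- Let μ, w be continuous functions on [0,T] with ∫₀ᵗ μ(t−τ) w(τ) dτ = 0 for all t ∈ [0,T]. If there exists T₀ ∈ (0,T] such that μ is not identically zero on (0,T₀), then w vanishes identically on (0, T−T₀). -/
open Real MeasureTheory Set

/-- real convolution on the line -/
noncomputable def cv (f g : ℝ → ℝ) : ℝ → ℝ := convolution f g (ContinuousLinearMap.mul ℝ ℝ) volume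

/-- `f` vanishes almost everywhere to the left of `s` -/
def Van (f : ℝ → ℝ) (s : ℝ) : Prop := ∀ᵐ t, t < s → f t = 0

lemma cv_apply (f g : ℝ → ℝ) (x : ℝ) : cv f g x = ∫ t, f t * g (x - t) := rfl

lemma cv_int {f g : ℝ → ℝ} (hf : Integrable f) (hg : Integrable g) : Integrable (cv f g) :=
  hf.integrable_convolution _ hg

lemma cv_ex {f g : ℝ → ℝ} (hf : Integrable f) (hg : Integrable g) :
    ∀ᵐ x, Integrable (fun t => f t * g (x - t)) :=
  hf.ae_convolution_exists (ContinuousLinearMap.mul ℝ ℝ) hg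

lemma cv_comm (f g : ℝ → ℝ) : cv f g = cv g f := by
  unfold cv
  rw [← convolution_flip]
  congr 1
  ext; simp

lemma cv_congr {f f' g g' : ℝ → ℝ} (h1 : f =ᵐ[volume] f') (h2 : g =ᵐ[volume] g') :
    cv f g = cv f' g' := convolution_congr _ h1 h2

lemma cv_assoc {f g k : ℝ → ℝ} (hf : Integrable f) (hg : Integrable g) (hk : Integrable k) :
    cv (cv f g) k =ᵐ[volume] cv f (cv g k) := by
  have h2 := Integrable.integrable_convolution (ContinuousLinearMap.mul ℝ ℝ) hg.norm hk.norm
  have h1 := hf.norm.ae_convolution_exists (ContinuousLinearMap.mul ℝ ℝ) h2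
  filter_upwards [h1] with x hx
  exact convolution_assoc _ _ _ _ (by intro x y z; simp [mul_assoc]) hf.1 hg.1 hk.1
    (hf.ae_convolution_exists _ hg) (hg.norm.ae_convolution_exists _ hk.norm) hx

lemma cv_four {f g k l : ℝ → ℝ} (hf : Integrable f) (hg : Integrable g) (hk : Integrable k)
    (hl : Integrable l) :
    cv (cv f g) (cv k l) =ᵐ[volume] cv (cv f l) (cv k g) := by
  have e1 := cv_assoc hf hg (cv_int hk hl)
  have e2 : cv g (cv k l) =ᵐ[volume] cv l (cv k g) := by
    have a := cv_assoc hk hl hg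
    rw [cv_comm g]
    refine a.trans ?_
    rw [cv_comm l g]
    refine (cv_assoc hk hg hl).symm.trans ?_
    rw [cv_comm l]
  refine e1.trans ?_
  rw [cv_congr (Filter.EventuallyEq.refl _ f) e2]
  exact (cv_assoc hf hl (cv_int hk hg)).symm

lemma Van.cv {f g : ℝ → ℝ} {a b : ℝ} (hf : Van f a) (hg : Van g b) : Van (cv f g) (a + b) := by
  refine Filter.Eventually.of_forall fun t ht => ?_
  rw [cv_apply]
  have hg' : ∀ᵐ x, t - x < b → g (t - x) = 0 :=
    (quasiMeasurePreserving_sub_left_of_right_invariant volume t).ae hg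
  apply integral_eq_zero_of_ae
  filter_upwards [hf, hg'] with x h1 h2
  by_cases h : x < a
  · simp [h1 h]
  · simp [h2 (by linarith)]

lemma Van.mono {f : ℝ → ℝ} {a b : ℝ} (hf : Van f a) (h : b ≤ a) : Van f b := by
  filter_upwards [hf] with x hx h' using hx (h'.trans_le h)

lemma Van.congr {f g : ℝ → ℝ} {a : ℝ} (hf : Van f a) (h : f =ᵐ[volume] g) : Van g a := by
  filter_upwards [hf, h] with x hx h' h2
  rw [← h', hx h2]

lemma exp_int {h : ℝ → ℝ} (hi : Integrable h) (h0 : Van h 0) {l : ℝ} (hl : 0 ≤ l) :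
    Integrable (fun u => exp (-l * u) * h u) := by
  refine hi.mono ((by fun_prop : Continuous fun u : ℝ => exp (-l * u)).aestronglyMeasurable.mul hi.1) ?_
  filter_upwards [h0] with u hu
  by_cases h : u < 0
  · simp [hu h]
  · rw [norm_mul, Real.norm_of_nonneg (exp_pos _).le]
    apply mul_le_of_le_one_left (norm_nonneg _)
    apply exp_le_one_iff.2
    nlinarith

lemma exp_norm_le {h : ℝ → ℝ} (hi : Integrable h) (h0 : Van h 0) {l : ℝ} (hl : 0 ≤ l) :
    ∫ u, ‖exp (-l * u) * h u‖ ≤ ∫ u, ‖h u‖ := by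
  refine integral_mono_ae (exp_int hi h0 hl).norm hi.norm ?_
  filter_upwards [h0] with u hu
  by_cases h : u < 0
  · simp [hu h]
  · rw [norm_mul, Real.norm_of_nonneg (exp_pos _).le]
    apply mul_le_of_le_one_left (norm_nonneg _)
    apply exp_le_one_iff.2
    nlinarith

lemma laplace_bound {h : ℝ → ℝ} (hi : Integrable h) (h0 : Van h 0) {s : ℝ}
    (hs : Van (cv h h) (2 * s)) :
    ∃ B : ℝ, 0 ≤ B ∧ ∀ l : ℝ, 0 ≤ l → |∫ u, exp (-l * u) * h u| ≤ B * exp (-l * s) := by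
  refine ⟨√(∫ x, ‖cv h h x‖), Real.sqrt_nonneg _, fun l hl => ?_⟩
  have hE := exp_int hi h0 hl
  have e1 : cv (fun u => exp (-l * u) * h u) (fun u => exp (-l * u) * h u)
      = fun x => exp (-l * x) * cv h h x := by
    ext x
    rw [cv_apply, cv_apply, ← integral_const_mul]
    congr 1
    ext t
    have : exp (-l * x) = exp (-l * t) * exp (-l * (x - t)) := by
      rw [← exp_add]; ring_nf
    rw [this]; ring
  have e2 : ∫ x, cv (fun u => exp (-l * u) * h u) (fun u => exp (-l * u) * h u) x
      = (∫ u, exp (-l * u) * h u) * (∫ u, exp (-l * u) * h u) :=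
    integral_convolution (ContinuousLinearMap.mul ℝ ℝ) hE hE
  have e3 : |∫ u, exp (-l * u) * h u| ^ 2 ≤ exp (-l * s) ^ 2 * ∫ x, ‖cv h h x‖ := by
    rw [sq_abs, sq, ← e2, ← integral_const_mul, e1]
    refine (Real.le_norm_self _).trans ((norm_integral_le_integral_norm _).trans ?_)
    have hc := cv_int hE hE
    rw [e1] at hc
    refine integral_mono_ae hc.norm ((cv_int hi hi).norm.const_mul _) ?_
    filter_upwards [hs] with x hx
    by_cases h : x < 2 * s
    · simp [hx h]
    · rw [norm_mul, Real.norm_of_nonneg (exp_pos _).le]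
      gcongr
      rw [← exp_nat_mul]
      apply exp_le_exp.2
      push_cast
      nlinarith
  rw [← pow_le_pow_iff_left₀ (abs_nonneg _) (by positivity) two_ne_zero]
  rw [mul_pow, Real.sq_sqrt (integral_nonneg fun _ => norm_nonneg _), mul_comm]
  exact e3

lemma series_bound {h : ℝ → ℝ} (hi : Integrable h) (h0 : Van h 0) {s B : ℝ} (hB0 : 0 ≤ B)
    (hB : ∀ l : ℝ, 0 ≤ l → |∫ u, exp (-l * u) * h u| ≤ B * exp (-l * s)) (r : ℝ) (n : ℕ) :
    |(∫ u, exp (-exp (n * (r - u))) * h u) - ∫ u, h u| ≤ B * (exp (exp (n * (r - s))) - 1) := by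
  set F : ℕ → ℝ → ℝ := fun k u => (-exp (n * (r - u))) ^ k / (k.factorial : ℝ) * h u with hF
  have hFe : ∀ k, F k = fun u => ((-1) ^ k * exp (n * r) ^ k / (k.factorial : ℝ)) *
      (exp (-((n : ℝ) * k) * u) * h u) := by
    intro k
    ext u
    have : (-exp (n * (r - u))) ^ k = (-1) ^ k * exp (n * r) ^ k * exp (-((n : ℝ) * k) * u) := by
      rw [neg_pow, ← exp_nat_mul, ← exp_nat_mul, mul_assoc, ← exp_add]
      ring_nf
    simp only [hF, this]
    ring
  have hnk : ∀ k : ℕ, (0 : ℝ) ≤ (n : ℝ) * k := fun k => by positivity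
  have hFi : ∀ k, Integrable (F k) := by
    intro k
    rw [hFe]
    exact (exp_int hi h0 (hnk k)).const_mul _
  have hFs : Summable fun k => ∫ u, ‖F k u‖ := by
    refine Summable.of_nonneg_of_le (fun k => integral_nonneg fun _ => norm_nonneg _) ?_
      ((Real.summable_pow_div_factorial (exp (n * r))).mul_right (∫ u, ‖h u‖))
    intro k
    rw [hFe]
    simp only [norm_mul _ (exp (-((n : ℝ) * k) * _) * h _)]
    rw [integral_const_mul]
    have : ‖(-1) ^ k * exp (n * r) ^ k / (k.factorial : ℝ)‖ = exp (n * r) ^ k / k.factorial := by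
      simp
    rw [this]
    exact mul_le_mul_of_nonneg_left (exp_norm_le hi h0 (hnk k)) (by positivity)
  have H := hasSum_integral_of_summable_integral_norm hFi hFs
  have e1 : ∀ u, ∑' k, F k u = exp (-exp (n * (r - u))) * h u := by
    intro u
    simp only [hF]
    rw [tsum_mul_right, Real.exp_eq_exp_ℝ, NormedSpace.exp_eq_tsum_div]
  simp only [e1] at H
  have H0 : ∫ u, F 0 u = ∫ u, h u := by simp [hF]
  have H1 := (hasSum_nat_add_iff' 1).2 H
  simp only [Finset.range_one, Finset.sum_singleton, H0] at H1
  have G : HasSum (fun k : ℕ => exp (n * (r - s)) ^ k / (k.factorial : ℝ)) (exp (exp (n * (r - s)))) := by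
    rw [Real.exp_eq_exp_ℝ]
    exact NormedSpace.expSeries_div_hasSum_exp _
  have G1 := ((hasSum_nat_add_iff' 1).2 G).mul_left B
  simp only [Finset.range_one, Finset.sum_singleton, pow_zero, Nat.factorial_zero, Nat.cast_one, div_one] at G1
  have key : ∀ k, ‖∫ u, F k u‖ ≤ B * (exp (n * (r - s)) ^ k / (k.factorial : ℝ)) := by
    intro k
    rw [hFe, integral_const_mul, norm_mul]
    have : ‖(-1) ^ k * exp (n * r) ^ k / (k.factorial : ℝ)‖ = exp (n * r) ^ k / k.factorial := by
      simp
    rw [this]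
    have h3 := hB _ (hnk k)
    have h4 : exp (n * (r - s)) ^ k = exp (n * r) ^ k * exp (-((n : ℝ) * k) * s) := by
      rw [← exp_nat_mul, ← exp_nat_mul, ← exp_add]
      ring_nf
    rw [h4]
    calc _ ≤ exp (n * r) ^ k / k.factorial * (B * exp (-((n : ℝ) * k) * s)) := by
          gcongr
          exact h3
      _ = _ := by ring
  have := tsum_of_norm_bounded G1 (fun k => key (k + 1))
  rw [H1.tsum_eq] at this
  exact this

lemma int_Ioi {h : ℝ → ℝ} (hi : Integrable h) (h0 : Van h 0) {s : ℝ}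
    (hs : Van (cv h h) (2 * s)) {r : ℝ} (hr : r < s) : ∫ u in Iic r, h u = 0 := by
  obtain ⟨B, hB0, hB⟩ := laplace_bound hi h0 hs
  have L1 : Filter.Tendsto (fun n : ℕ => ∫ u, exp (-exp (n * (r - u))) * h u) Filter.atTop
      (nhds (∫ u, (Ioi r).indicator h u)) := by
    refine tendsto_integral_of_dominated_convergence (fun u => ‖h u‖) ?_ hi.norm ?_ ?_
    · intro n
      exact (by fun_prop : Continuous fun u : ℝ => exp (-exp (n * (r - u)))).aestronglyMeasurable.mul hi.1
    · intro n
      refine Filter.Eventually.of_forall fun u => ?_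
      rw [norm_mul, Real.norm_of_nonneg (exp_pos _).le]
      apply mul_le_of_le_one_left (norm_nonneg _)
      apply exp_le_one_iff.2
      have := exp_pos (n * (r - u))
      linarith
    · have hne : ∀ᵐ u : ℝ, u ≠ r := by simp [ae_iff]
      filter_upwards [hne] with u hu
      rcases lt_or_gt_of_ne hu with h1 | h1
      · have : (Ioi r).indicator h u = 0 * h u := by
          rw [indicator_of_notMem (by simp [h1.le])]; simp
        rw [this]
        refine Filter.Tendsto.mul_const _ ?_
        apply Real.tendsto_exp_neg_atTop_nhds_zero.comp
        apply Real.tendsto_exp_atTop.comp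
        exact tendsto_natCast_atTop_atTop.atTop_mul_const (by linarith)
      · have : (Ioi r).indicator h u = exp (-0) * h u := by
          rw [indicator_of_mem (by simpa using h1)]; simp
        rw [this]
        refine Filter.Tendsto.mul_const _ ?_
        apply (Real.continuous_exp.tendsto _).comp
        apply Filter.Tendsto.neg
        apply Real.tendsto_exp_atBot.comp
        exact tendsto_natCast_atTop_atTop.atTop_mul_const_of_neg (by linarith)
  have L2 : Filter.Tendsto (fun n : ℕ => B * (exp (exp (n * (r - s))) - 1)) Filter.atTop
      (nhds (B * (exp 0 - 1))) := by
    refine Filter.Tendsto.const_mul _ (Filter.Tendsto.sub_const ?_ _)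
    apply (Real.continuous_exp.tendsto _).comp
    apply Real.tendsto_exp_atBot.comp
    exact tendsto_natCast_atTop_atTop.atTop_mul_const_of_neg (by linarith)
  have L3 := le_of_tendsto_of_tendsto' (L1.sub_const (∫ u, h u)).abs L2
    (fun n => series_bound hi h0 hB0 hB r n)
  simp only [exp_zero, sub_self, mul_zero, abs_nonpos_iff] at L3
  rw [integral_indicator measurableSet_Ioi] at L3
  have := intervalIntegral.integral_Iic_add_Ioi (b := r) hi.integrableOn hi.integrableOn
  linarith

lemma square_van {h : ℝ → ℝ} (hi : Integrable h) (h0 : Van h 0) {s : ℝ}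
    (hs : Van (cv h h) (2 * s)) : Van h s := by
  have key : ∀ r, r < s → ∫ u in Iic r, h u = 0 := fun r hr => int_Ioi hi h0 hs hr
  -- it suffices to treat a smaller half-line
  suffices H : ∀ r, r < s → ∀ᵐ t, t ≤ r → h t = 0 by
    have H' : ∀ n : ℕ, ∀ᵐ t, t ≤ s - 1 / ((n : ℝ) + 1) → h t = 0 := fun n => by
      apply H
      have : (0 : ℝ) < 1 / ((n : ℝ) + 1) := by positivity
      linarith
    filter_upwards [ae_all_iff.2 H'] with t ht hts
    obtain ⟨n, hn⟩ := exists_nat_one_div_lt (sub_pos.2 hts)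
    exact ht n (by linarith)
  intro r hr
  have hi' : Integrable h (volume.restrict (Iic r)) := hi.integrableOn
  have hz : h =ᵐ[volume.restrict (Iic r)] 0 := by
    refine hi'.ae_eq_zero_of_forall_setIntegral_eq_zero fun A hA hfin => ?_
    clear hfin
    induction A, hA using MeasurableSpace.induction_on_inter
      (borel_eq_generateFrom_Iic ℝ ▸ (BorelSpace.measurable_eq (α := ℝ))) isPiSystem_Iic with
    | empty => simp
    | basic t ht =>
      obtain ⟨a, rfl⟩ := ht
      rw [Measure.restrict_restrict measurableSet_Iic, Iic_inter_Iic]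
      exact key _ ((inf_le_right).trans_lt hr)
    | compl t htm ih =>
      have h1 := integral_add_compl htm hi'
      have h2 := key r hr
      linarith
    | iUnion f hd hm ih =>
      rw [integral_iUnion hm hd hi'.integrableOn]
      simp [ih]
  exact (ae_restrict_iff' measurableSet_Iic).1 hz

lemma Van.closed {f : ℝ → ℝ} {s : ℝ} (H : ∀ r < s, Van f r) : Van f s := by
  have H' : ∀ n : ℕ, Van f (s - 1 / ((n : ℝ) + 1)) := fun n => by
    apply H
    have : (0 : ℝ) < 1 / ((n : ℝ) + 1) := by positivity
    linarith
  filter_upwards [ae_all_iff.2 H'] with t ht hts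
  obtain ⟨n, hn⟩ := exists_nat_one_div_lt (sub_pos.2 hts)
  exact ht n (by linarith)

lemma key_step {F G F' G' : ℝ → ℝ} (hF : Integrable F) (hG : Integrable G)
    (hF' : Integrable F') (hG' : Integrable G')
    (eF : ∀ t, F' t = t * F t) (eG : ∀ t, G' t = t * G t)
    (F0 : Van F 0) (G0 : Van G 0) {a b c : ℝ}
    (ha : Van (cv F G) a) (hb : Van (cv F G') b) (hc : Van (cv F' G') c) :
    Van (cv F G') ((a + min b c) / 2) := by
  have G0' : Van G' 0 := by
    filter_upwards [G0] with t h1 h2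
    rw [eG, h1 h2, mul_zero]
  have hk : (fun x => x * cv F G x) =ᵐ[volume] cv F' G + cv F G' := by
    filter_upwards [cv_ex hF' hG, cv_ex hF hG'] with x h1 h2
    simp only [Pi.add_apply, cv_apply]
    rw [← integral_add h1 h2, ← integral_const_mul]
    congr 1
    ext t
    rw [eF, eG]; ring
  have hXa : Van (fun x => x * cv F G x) a := by
    filter_upwards [ha] with t h1 h2
    rw [h1 h2, mul_zero]
  have ih := cv_int hF hG'
  have il := cv_int hF' hG
  have e1 : cv (cv F G') (fun x => x * cv F G x) = cv (cv F G') (cv F' G + cv F G') :=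
    cv_congr (Filter.EventuallyEq.refl _ _) hk
  have e2 : cv (cv F G') (cv F' G + cv F G') =ᵐ[volume]
      cv (cv F G') (cv F' G) + cv (cv F G') (cv F G') := by
    filter_upwards [cv_ex ih il, cv_ex ih ih] with x h1 h2
    exact ConvolutionExistsAt.distrib_add (L := ContinuousLinearMap.mul ℝ ℝ) h1 h2
  have v1 : Van (cv (cv F G') (fun x => x * cv F G x)) (a + min b c) := by
    have := hb.cv hXa
    refine this.mono ?_
    linarith [min_le_left b c]
  have v2 : Van (cv (cv F G') (cv F' G)) (a + min b c) := by
    refine Van.congr ?_ (cv_four hF hG' hF' hG).symm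
    refine (ha.cv hc).mono ?_
    linarith [min_le_right b c]
  have v0 : Van (cv F G') 0 := by simpa using F0.cv G0'
  refine square_van ih v0 ?_
  rw [mul_div_cancel₀ _ (two_ne_zero)]
  rw [e1] at v1
  filter_upwards [v1, v2, e2] with x h1 h2 h3 hx
  rw [h1 hx, Pi.add_apply, h2 hx] at h3
  linarith

lemma walk {P : ℕ → ℝ → Prop} {T : ℝ} (hT : 0 ≤ T) (h0 : ∀ k, P k 0)
    (hmono : ∀ k a b, P k a → b ≤ a → P k b)
    (hcl : ∀ k s, (∀ r < s, P k r) → P k s) (hPT : P 0 T)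
    (hstep : ∀ k a b c, P k a → P (k + 1) b → P (k + 2) c → P (k + 1) ((a + min b c) / 2)) :
    ∀ k, P k T := by
  have hex : ∀ k, ∃ d, (0 ≤ d ∧ d ≤ T ∧ P k d) ∧ ∀ s, s ≤ T → P k s → s ≤ d := by
    intro k
    set S := {s | s ≤ T ∧ P k s} with hS
    have hb : BddAbove S := ⟨T, fun s hs => hs.1⟩
    have hn : S.Nonempty := ⟨0, hT, h0 k⟩
    refine ⟨sSup S, ⟨le_csSup hb ⟨hT, h0 k⟩, csSup_le hn fun s hs => hs.1, ?_⟩,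
      fun s h1 h2 => le_csSup hb ⟨h1, h2⟩⟩
    apply hcl
    intro r hr
    obtain ⟨s, hs, hrs⟩ := exists_lt_of_lt_csSup hn hr
    exact hmono _ _ _ hs.2 hrs.le
  choose d hd hmax using hex
  have hrec : ∀ k, (d k + min (d (k + 1)) (d (k + 2))) / 2 ≤ d (k + 1) := by
    intro k
    refine hmax _ _ ?_ (hstep k _ _ _ (hd _).2.2 (hd _).2.2 (hd _).2.2)
    linarith [min_le_left (d (k + 1)) (d (k + 2)), (hd k).2.1, (hd (k + 1)).2.1]
  have hinc : ∀ n, d n ≤ d (n + 1) := by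
    intro n
    by_contra! hlt
    set δ := d n - d (n + 1) with hδ
    have hδ0 : 0 < δ := by linarith
    have hdec : ∀ m, d (n + m + 1) ≤ d (n + m) - δ := by
      intro m
      induction m with
      | zero => simp [hδ]
      | succ m ih =>
        have := hrec (n + m)
        rcases min_choice (d (n + m + 1)) (d (n + m + 2)) with h | h
        · rw [h] at this; linarith
        · rw [h] at this
          have e : n + (m + 1) = n + m + 1 := rfl
          rw [e]
          linarith
    have hlin : ∀ m : ℕ, d (n + m) ≤ T - m * δ := by
      intro m
      induction m with
      | zero => simpa using (hd n).2.1
      | succ m ih =>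
        have := hdec m
        push_cast
        rw [← add_assoc]
        linarith
    obtain ⟨m, hm⟩ := exists_nat_gt (T / δ)
    rw [div_lt_iff₀ hδ0] at hm
    linarith [hlin m, (hd (n + m)).1]
  have hall : ∀ k, T ≤ d k := by
    intro k
    induction k with
    | zero => exact hmax 0 T le_rfl hPT
    | succ k ih => exact ih.trans (hinc k)
  exact fun k => hmono _ _ _ (hd k).2.2 (hall k)

lemma moments {φ : ℝ → ℝ} {t : ℝ} (htp : 0 < t) (hφ : ContinuousOn φ (Icc 0 t))
    (hm : ∀ j : ℕ, ∫ x in (0:ℝ)..t, x ^ j * φ x = 0) : ∀ x ∈ Icc 0 t, φ x = 0 := by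
  have ht : 0 ≤ t := htp.le
  have hu : uIcc 0 t = Icc 0 t := uIcc_of_le ht
  have ii : ∀ {f : ℝ → ℝ}, ContinuousOn f (Icc 0 t) → IntervalIntegrable f volume 0 t := by
    intro f hf
    exact ContinuousOn.intervalIntegrable (by rwa [hu])
  have hp : ∀ p : Polynomial ℝ, ∫ x in (0:ℝ)..t, p.eval x * φ x = 0 := by
    intro p
    have : ∀ x, p.eval x * φ x = ∑ j ∈ Finset.range (p.natDegree + 1), p.coeff j * (x ^ j * φ x) := by
      intro x
      rw [Polynomial.eval_eq_sum_range, Finset.sum_mul]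
      simp only [mul_assoc]
    simp only [this]
    rw [intervalIntegral.integral_finsetSum]
    · simp [hm]
    · intro j _
      exact ii (by fun_prop)
  have hsq : ∫ x in (0:ℝ)..t, φ x * φ x = 0 := by
    apply le_antisymm _ (intervalIntegral.integral_nonneg ht fun x _ => mul_self_nonneg _)
    apply le_of_forall_pos_le_add
    intro ε hε
    set A := ∫ x in (0:ℝ)..t, |φ x| with hA
    have hA0 : 0 ≤ A := intervalIntegral.integral_nonneg ht fun x _ => abs_nonneg _
    obtain ⟨p, hpp⟩ := exists_polynomial_near_of_continuousOn 0 t φ hφ (ε / (A + 1)) (by positivity)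
    have e : ∫ x in (0:ℝ)..t, φ x * φ x = ∫ x in (0:ℝ)..t, (φ x * φ x - p.eval x * φ x) := by
      rw [intervalIntegral.integral_sub (ii (by fun_prop)) (ii (by fun_prop)), hp, sub_zero]
    rw [e, zero_add]
    calc _ ≤ ∫ x in (0:ℝ)..t, ε / (A + 1) * |φ x| := by
          apply intervalIntegral.integral_mono_on ht (ii (by fun_prop)) (ii (by fun_prop))
          intro x hx
          have h1 := (hpp x hx).le
          rw [abs_sub_comm] at h1
          calc _ ≤ |φ x * φ x - p.eval x * φ x| := le_abs_self _
            _ = |φ x - p.eval x| * |φ x| := by rw [← abs_mul]; ring_nf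
            _ ≤ _ := by gcongr
      _ = ε * (A / (A + 1)) := by
          rw [intervalIntegral.integral_const_mul, ← hA]; ring
      _ ≤ ε * 1 := by
          gcongr
          rw [div_le_one (by positivity)]
          linarith
      _ = ε := mul_one _
  intro x hx
  by_contra hne
  have : 0 < ∫ x in (0:ℝ)..t, φ x * φ x := by
    apply intervalIntegral.integral_pos htp (by fun_prop) (fun x _ => mul_self_nonneg _)
    exact ⟨x, hx, mul_self_pos.2 hne⟩
  linarith

lemma cut_int {T : ℝ} {μ : ℝ → ℝ} (hμ : ContinuousOn μ (Icc 0 T)) (i : ℕ) :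
    Integrable (fun t => t ^ i * (Icc 0 T).indicator μ t) := by
  have : (fun t => t ^ i * (Icc 0 T).indicator μ t) = (Icc 0 T).indicator fun t => t ^ i * μ t := by
    ext t
    by_cases h : t ∈ Icc 0 T <;> simp [h]
  rw [this, integrable_indicator_iff measurableSet_Icc]
  exact ContinuousOn.integrableOn_Icc (by fun_prop)

lemma cut_van {T : ℝ} (μ : ℝ → ℝ) (i : ℕ) :
    Van (fun t => t ^ i * (Icc 0 T).indicator μ t) 0 := by
  refine Filter.Eventually.of_forall fun t ht => ?_
  have : t ∉ Icc 0 T := fun h => absurd h.1 (by linarith)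
  simp only [indicator_of_notMem this, mul_zero]

lemma cut_cv {T t : ℝ} (μ w : ℝ → ℝ) (j : ℕ) (h0 : 0 ≤ t) (hT : t ≤ T) :
    cv (fun t => t ^ 0 * (Icc 0 T).indicator μ t) (fun t => t ^ j * (Icc 0 T).indicator w t) t
      = ∫ x in (0:ℝ)..t, x ^ j * (μ (t - x) * w x) := by
  rw [cv_comm, cv_apply, intervalIntegral.integral_of_le h0, ← integral_Icc_eq_integral_Ioc,
    ← integral_indicator measurableSet_Icc]
  congr 1
  ext x
  by_cases hx : x ∈ Icc 0 t
  · rw [indicator_of_mem hx, indicator_of_mem, indicator_of_mem]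
    · ring
    · exact ⟨by linarith [hx.2], by linarith [hx.1]⟩
    · exact ⟨hx.1, hx.2.trans hT⟩
  · rw [indicator_of_notMem hx]
    by_cases h1 : x < 0
    · rw [indicator_of_notMem (s := Icc 0 T) (a := x)]
      · simp
      · exact fun h => absurd h.1 (by linarith)
    · rw [indicator_of_notMem (s := Icc 0 T) (a := t - x)]
      · simp
      · intro h
        exact hx ⟨by linarith, by linarith [h.1]⟩

/-- Titchmarsh-type corollary: if `μ, w` are continuous on `[0,T]` with
`∫₀ᵗ μ(t−τ) w(τ) dτ = 0` for all `t ∈ [0,T]`, and `μ` is not identically zero on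
`(0,T₀)` for some `T₀ ∈ (0,T]`, then `w` vanishes identically on `(0, T−T₀)`. -/
theorem titchmarsh_corollary (T T₀ : ℝ) (hT : 0 < T) (hT₀ : 0 < T₀) (hT₀T : T₀ ≤ T)
    (μ w : ℝ → ℝ) (hμc : ContinuousOn μ (Set.Icc 0 T)) (hwc : ContinuousOn w (Set.Icc 0 T))
    (hconv : ∀ t ∈ Set.Icc (0:ℝ) T, ∫ τ in (0:ℝ)..t, μ (t - τ) * w τ = 0)
    (hμne : ¬ ∀ t ∈ Set.Ioo (0:ℝ) T₀, μ t = 0) :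
    ∀ t ∈ Set.Ioo (0:ℝ) (T - T₀), w t = 0 := by
  set f : ℕ → ℝ → ℝ := fun i t => t ^ i * (Icc 0 T).indicator μ t with hf
  set g : ℕ → ℝ → ℝ := fun i t => t ^ i * (Icc 0 T).indicator w t with hg
  have fi : ∀ i, Integrable (f i) := cut_int hμc
  have gi : ∀ i, Integrable (g i) := cut_int hwc
  have f0 : ∀ i, Van (f i) 0 := cut_van μ
  have g0 : ∀ i, Van (g i) 0 := cut_van w
  have fs : ∀ i t, f (i + 1) t = t * f i t := fun i t => by simp only [hf]; ring
  have gs : ∀ i t, g (i + 1) t = t * g i t := fun i t => by simp only [hg]; ring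
  have fg0 : ∀ i j, Van (cv (f i) (g j)) 0 := fun i j => by simpa using (f0 i).cv (g0 j)
  have hP : ∀ k i j, i + j = k → Van (cv (f i) (g j)) T := by
    refine walk (P := fun k s => ∀ i j, i + j = k → Van (cv (f i) (g j)) s) hT.le ?_ ?_ ?_ ?_ ?_
    · exact fun k i j _ => fg0 i j
    · exact fun k a b h hab i j hij => (h i j hij).mono hab
    · exact fun k s h i j hij => Van.closed fun r hr => h r hr i j hij
    · intro i j hij
      obtain ⟨rfl, rfl⟩ : i = 0 ∧ j = 0 := by omega
      filter_upwards [fg0 0 0] with t h1 h2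
      by_cases ht : t < 0
      · exact h1 ht
      · push Not at ht
        rw [hf, hg]
        rw [cut_cv μ w 0 ht h2.le]
        simpa using hconv t ⟨ht, h2.le⟩
    · intro k a b c ha hb hc i j hij
      rcases j with _ | j
      · obtain ⟨i, rfl⟩ : ∃ i', i = i' + 1 := ⟨k, by omega⟩
        have h1 := ha i 0 (by omega)
        have h2 := hb (i + 1) 0 (by omega)
        have h3 := hc (i + 1) 1 (by omega)
        rw [cv_comm] at h1 h2 h3 ⊢
        exact key_step (gi 0) (fi i) (gi 1) (fi (i + 1)) (gs 0) (fs i) (g0 0) (f0 i) h1 h2 h3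
      · exact key_step (fi i) (gi j) (fi (i + 1)) (gi (j + 1)) (fs i) (gs j) (f0 i) (g0 j)
          (ha i j (by omega)) (hb i (j + 1) (by omega)) (hc (i + 1) (j + 1) (by omega))
  have hae : ∀ᵐ t, ∀ j, t < T → cv (f 0) (g j) t = 0 :=
    ae_all_iff.2 fun j => hP (0 + j) 0 j rfl
  intro t ht
  push Not at hμne
  obtain ⟨s, hs, hμs⟩ := hμne
  have hμat : ContinuousAt μ s := hμc.continuousAt (Icc_mem_nhds hs.1 (hs.2.trans_le hT₀T))
  have hcomp : ContinuousAt (fun x => μ (x - t)) (s + t) := by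
    apply ContinuousAt.comp (g := μ) (f := fun x => x - t)
    · simpa using hμat
    · fun_prop
  have hnb : ∀ᶠ x in nhds (s + t), μ (x - t) ≠ 0 :=
    hcomp.eventually_ne (by simpa using hμs)
  have hnb2 : ∀ᶠ x in nhds (s + t), x ∈ Ioo t T :=
    Ioo_mem_nhds (by linarith [hs.1]) (by linarith [hs.2, ht.2])
  obtain ⟨x, hx1, hx2, hx3⟩ := (Measure.dense_of_ae hae).inter_nhds_nonempty (hnb.and hnb2)
  have hxp : 0 < x := by linarith [ht.1, hx3.1]
  have hx0 := hxp.le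
  have hm := moments (φ := fun y => μ (x - y) * w y) hxp ?_ ?_ t ⟨ht.1.le, hx3.1.le⟩
  · exact (mul_eq_zero.1 hm).resolve_left hx2
  · apply ContinuousOn.mul
    · apply hμc.comp (by fun_prop)
      intro y hy
      exact ⟨by linarith [hy.2], by linarith [hy.1, hx3.2]⟩
    · exact hwc.mono (Icc_subset_Icc_right hx3.2.le)
  · intro j
    rw [← cut_cv μ w j hx0 hx3.2.le]
    exact hx1 j hx3.2
end
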